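/- arXiv:2108.13330 — 3 statements merged into one kernel-verified Lean document; each statement's English description precedes it below -/
import Mathlib

section
/- The second moment of s₃(r) − 1 satisfies ∫₀^∞ r²(s₃(r) − 1) dr = −8/(3√π). -/
open MeasureTheory Real Filter

/-- The error function `erf(r) = (2/√π) ∫₀^r e^{−t²} dt`. -/
noncomputable def erf (r : ℝ) : ℝ :=
  (2 / Real.sqrt Real.pi) * ∫ t in (0:ℝ)..r, Real.exp (-t ^ 2)

/-- The smoothing function `s₃(r) = erf(r) − 2r((2/3)r² + 1)e^{−r²}/√π`. -/
noncomputable def s3 (r : ℝ) : ℝ :=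
  erf r - 2 * r * ((2 / 3) * r ^ 2 + 1) * Real.exp (-r ^ 2) / Real.sqrt Real.pi

theorem integrable_exp_neg_sq : Integrable fun t : ℝ => Real.exp (-t ^ 2) := by
  simpa using integrable_exp_neg_mul_sq (b := 1) one_pos

theorem one_sub_erf (r : ℝ) :
    1 - erf r = (2 / √π) * ∫ t in Set.Ioi r, Real.exp (-t ^ 2) := by
  have hsplit := intervalIntegral.integral_interval_add_Ioi (a := 0) (b := r) (μ := volume)
    integrable_exp_neg_sq.integrableOn integrable_exp_neg_sq.integrableOn
  have hgauss : ∫ t in Set.Ioi (0 : ℝ), Real.exp (-t ^ 2) = √π / 2 := by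
    simpa using integral_gaussian_Ioi 1
  have hpi : √π ≠ 0 := (Real.sqrt_pos.2 Real.pi_pos).ne'
  rw [erf, sub_eq_iff_eq_add', ← mul_add, hsplit, hgauss]
  field_simp

theorem erf_le_one (r : ℝ) : erf r ≤ 1 := by
  rw [← sub_nonneg, one_sub_erf]
  have : 0 ≤ ∫ t in Set.Ioi r, Real.exp (-t ^ 2) := integral_nonneg fun t => (exp_pos _).le
  positivity

theorem one_sub_erf_le {r : ℝ} (hr : 1 ≤ r) : 1 - erf r ≤ (2 / √π) * Real.exp (-r) := by
  rw [one_sub_erf, ← integral_exp_neg_Ioi r]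
  refine mul_le_mul_of_nonneg_left ?_ (by positivity)
  refine setIntegral_mono_on integrable_exp_neg_sq.integrableOn
    (integrableOn_exp_neg_Ioi r) measurableSet_Ioi fun t ht => ?_
  have ht' : r < t := ht
  exact exp_le_exp.2 (by nlinarith)

theorem hasDerivAt_erf (r : ℝ) : HasDerivAt erf ((2 / √π) * Real.exp (-r ^ 2)) r := by
  have hcont : Continuous fun t : ℝ => Real.exp (-t ^ 2) := by fun_prop
  exact (hcont.integral_hasStrictDerivAt 0 r).hasDerivAt.const_mul (2 / √π)

theorem tendsto_pow_mul_one_sub_erf_atTop (n : ℕ) :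
    Tendsto (fun r => r ^ n * (1 - erf r)) atTop (nhds 0) := by
  have hlim : Tendsto (fun r : ℝ => (2 / √π) * (r ^ n * Real.exp (-r))) atTop (nhds 0) := by
    simpa using (tendsto_pow_mul_exp_neg_atTop_nhds_zero n).const_mul (2 / √π)
  refine tendsto_of_tendsto_of_tendsto_of_le_of_le' tendsto_const_nhds hlim ?_ ?_
  · filter_upwards [eventually_ge_atTop 0] with r hr
    exact mul_nonneg (pow_nonneg hr n) (sub_nonneg.2 (erf_le_one r))
  · filter_upwards [eventually_ge_atTop 1] with r hr
    rw [mul_left_comm]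
    exact mul_le_mul_of_nonneg_left (one_sub_erf_le hr) (pow_nonneg (by linarith) n)

theorem tendsto_pow_mul_exp_neg_sq_atTop (n : ℕ) :
    Tendsto (fun r : ℝ => r ^ n * Real.exp (-r ^ 2)) atTop (nhds 0) := by
  refine tendsto_of_tendsto_of_tendsto_of_le_of_le' tendsto_const_nhds
    (tendsto_pow_mul_exp_neg_atTop_nhds_zero n) ?_ ?_
  · filter_upwards [eventually_ge_atTop 0] with r hr
    positivity
  · filter_upwards [eventually_ge_atTop 1] with r hr
    gcongr
    nlinarith

theorem s3_le_one {r : ℝ} (hr : 0 ≤ r) : s3 r ≤ 1 := by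
  have : 0 ≤ 2 * r * ((2 / 3) * r ^ 2 + 1) * Real.exp (-r ^ 2) / √π := by positivity
  exact (sub_le_self _ this).trans (erf_le_one r)

/-- An antiderivative of `r ^ 2 * (s3 r - 1)`, vanishing at infinity. -/
noncomputable def secondMomentPrimitive (r : ℝ) : ℝ :=
  (2 / 3 * r ^ 4 + 8 / 3 * r ^ 2 + 8 / 3) * Real.exp (-r ^ 2) / √π - r ^ 3 * (1 - erf r) / 3

theorem hasDerivAt_secondMomentPrimitive (r : ℝ) :
    HasDerivAt secondMomentPrimitive (r ^ 2 * (s3 r - 1)) r := by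
  have hexp : HasDerivAt (fun x : ℝ => Real.exp (-x ^ 2)) (Real.exp (-r ^ 2) * -(2 * r)) r := by
    simpa using ((hasDerivAt_pow 2 r).neg).exp
  have hpoly := ((((hasDerivAt_pow 4 r).const_mul (2 / 3)).add
    ((hasDerivAt_pow 2 r).const_mul (8 / 3))).add_const (8 / 3))
  have hmain := ((hpoly.mul hexp).div_const √π).sub
    (((hasDerivAt_pow 3 r).mul ((hasDerivAt_erf r).const_sub 1)).div_const 3)
  refine hmain.congr_deriv ?_
  simp only [s3, Pi.add_apply]
  push_cast
  ring

theorem tendsto_secondMomentPrimitive_atTop :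
    Tendsto secondMomentPrimitive atTop (nhds 0) := by
  have hlim := (((((tendsto_pow_mul_exp_neg_sq_atTop 4).const_mul (2 / 3)).add
    ((tendsto_pow_mul_exp_neg_sq_atTop 2).const_mul (8 / 3))).add
    ((tendsto_pow_mul_exp_neg_sq_atTop 0).const_mul (8 / 3))).div_const √π).sub
    ((tendsto_pow_mul_one_sub_erf_atTop 3).div_const 3)
  convert hlim using 1
  · ext r
    simp only [secondMomentPrimitive]
    ring
  · simp

/-- `∫₀^∞ r²(s₃(r) − 1) dr = −8/(3√π)`. -/
theorem second_moment_s3_sub_one :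
    ∫ r in Set.Ioi (0:ℝ), r ^ 2 * (s3 r - 1) = -(8 / (3 * Real.sqrt Real.pi)) := by
  rw [integral_Ioi_of_hasDerivAt_of_nonpos' (fun r _ => hasDerivAt_secondMomentPrimitive r)
    (fun r hr => mul_nonpos_of_nonneg_of_nonpos (sq_nonneg r)
      (sub_nonpos.2 (s3_le_one (le_of_lt hr)))) tendsto_secondMomentPrimitive_atTop]
  simp [secondMomentPrimitive, div_div]
end

section
/- The smoothing function s₃(r) = erf(r) − 2r((2/3)r² + 1)e^{−r²}/√π vanishes to fifth order at 0: the limit of s₃(r)/r⁵ as r → 0 (r ≠ 0) exists and equals 8/(15√π). -/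
open MeasureTheory Real Filter

/-- The derivative of `s3` is `8 r⁴ e^{−r²} / (3√π)`. -/
theorem hasDerivAt_s3 (r : ℝ) :
    HasDerivAt s3 (8 / (3 * √π) * r ^ 4 * exp (-r ^ 2)) r := by
  have h_int : HasDerivAt (fun x : ℝ => ∫ t in (0 : ℝ)..x, exp (-t ^ 2)) (exp (-r ^ 2)) r :=
    intervalIntegral.integral_hasDerivAt_right
      (Continuous.intervalIntegrable (by fun_prop) _ _)
      (Continuous.stronglyMeasurableAtFilter (by fun_prop) _ _)
      (Continuous.continuousAt (by fun_prop))
  have h_exp : HasDerivAt (fun x : ℝ => exp (-x ^ 2)) (exp (-r ^ 2) * (-(2 * r))) r := by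
    simpa using ((hasDerivAt_pow 2 r).neg).exp
  have h_poly : HasDerivAt (fun x : ℝ => 2 * x * ((2 / 3) * x ^ 2 + 1)) (4 * r ^ 2 + 2) r := by
    have h := ((hasDerivAt_id r).const_mul 2).mul
      (((hasDerivAt_pow 2 r).const_mul (2 / 3)).add_const 1)
    refine h.congr_deriv ?_
    simp only [id]
    push_cast
    ring
  refine ((h_int.const_mul (2 / √π)).sub ((h_poly.mul h_exp).div_const √π)).congr_deriv ?_
  have : √π ≠ 0 := by positivity
  field_simp
  ring

/-- `s₃(r)/r⁵ → 8/(15√π)` as `r → 0`, `r ≠ 0`. -/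
theorem tendsto_s3_div_pow_five :
    Filter.Tendsto (fun r : ℝ => s3 r / r ^ 5) (nhdsWithin 0 {0}ᶜ)
      (nhds (8 / (15 * Real.sqrt Real.pi))) := by
  have h_ratio : Tendsto (fun r : ℝ => (8 / (3 * √π) * r ^ 4 * exp (-r ^ 2)) / (5 * r ^ 4))
      (nhdsWithin 0 {0}ᶜ) (nhds (8 / (15 * √π))) := by
    have h : Tendsto (fun r : ℝ => 8 / (15 * √π) * exp (-r ^ 2)) (nhdsWithin 0 {0}ᶜ)
        (nhds (8 / (15 * √π))) := by
      have hc : Continuous fun r : ℝ => 8 / (15 * √π) * exp (-r ^ 2) := by fun_prop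
      simpa using (hc.tendsto 0).mono_left nhdsWithin_le_nhds
    refine h.congr' ?_
    filter_upwards [self_mem_nhdsWithin] with r hr
    have : r ≠ 0 := hr
    field_simp
    norm_num
  refine HasDerivAt.lhopital_zero_nhdsNE (.of_forall hasDerivAt_s3)
    (.of_forall fun r => by simpa using hasDerivAt_pow 5 r) ?_ ?_ ?_ h_ratio
  · filter_upwards [self_mem_nhdsWithin] with r hr
    have : r ≠ 0 := hr
    positivity
  · simpa [s3, erf] using (hasDerivAt_s3 0).continuousAt.tendsto.mono_left nhdsWithin_le_nhds
  · simpa using ((continuous_pow 5).tendsto (0 : ℝ)).mono_left nhdsWithin_le_nhds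
end

section
/- The smoothing function s₃(r) = erf(r) − 2r((2/3)r² + 1)e^{−r²}/√π factors to fifth order through an analytic function: there exists a function g : ℝ → ℝ that is real-analytic on all of ℝ such that s₃(r) = r⁵ · g(r) for every real r. -/
open MeasureTheory Real Filter

/-- If `F` is differentiable in its first variable, with `F` and its derivative jointly continuous,
then `z ↦ ∫ u in a..b, F z u` is complex differentiable. -/
theorem differentiable_intervalIntegral_of_continuous_deriv {F F' : ℂ → ℝ → ℂ} {a b : ℝ}
    (hF : Continuous (Function.uncurry F)) (hF' : Continuous (Function.uncurry F'))
    (hd : ∀ z u, HasDerivAt (fun w => F w u) (F' z u) z) :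
    Differentiable ℂ fun z => ∫ u in a..b, F z u := by
  intro z₀
  obtain ⟨C, hC⟩ := ((isCompact_closedBall z₀ 1).prod (isCompact_uIcc (a := a) (b := b))
    ).exists_bound_of_continuousOn hF'.continuousOn
  have hcF (z : ℂ) : Continuous (F z) := hF.comp (Continuous.prodMk_right z)
  have hcF' (z : ℂ) : Continuous (F' z) := hF'.comp (Continuous.prodMk_right z)
  exact (intervalIntegral.hasDerivAt_integral_of_dominated_loc_of_deriv_le
    (bound := fun _ => C) (Metric.closedBall_mem_nhds z₀ one_pos)
    (.of_forall fun z => (hcF z).aestronglyMeasurable)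
    ((hcF z₀).intervalIntegrable a b) (hcF' z₀).aestronglyMeasurable
    (.of_forall fun u hu z hz => hC (z, u) ⟨hz, Set.uIoc_subset_uIcc hu⟩)
    intervalIntegrable_const
    (.of_forall fun u _ z _ => hd z u)).2.differentiableAt

theorem differentiable_integral_pow_four_mul_cexp :
    Differentiable ℂ fun z : ℂ => ∫ u in (0 : ℝ)..1, (u : ℂ) ^ 4 * Complex.exp (-(z * u) ^ 2) := by
  refine differentiable_intervalIntegral_of_continuous_deriv
    (F' := fun z u => (u : ℂ) ^ 4 * (Complex.exp (-(z * u) ^ 2) * -(2 * (z * u) * u)))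
    (by fun_prop) (by fun_prop) fun z u => ?_
  have h := (((((hasDerivAt_id z).mul_const (u : ℂ)).pow 2).neg).cexp).const_mul ((u : ℂ) ^ 4)
  exact h.congr_deriv (by simp)

theorem analyticAt_integral_pow_four_mul_exp (x : ℝ) :
    AnalyticAt ℝ (fun r : ℝ => ∫ u in (0 : ℝ)..1, u ^ 4 * exp (-(r * u) ^ 2)) x := by
  have h : AnalyticAt ℝ (fun r : ℝ =>
      (∫ u in (0 : ℝ)..1, (u : ℂ) ^ 4 * Complex.exp (-((r : ℂ) * u) ^ 2)).re) x :=
    (differentiable_integral_pow_four_mul_cexp.analyticAt (x : ℂ)).re_ofReal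
  convert h using 2 with r
  rw [← Complex.ofReal_re (∫ u in (0 : ℝ)..1, u ^ 4 * exp (-(r * u) ^ 2)),
    ← intervalIntegral.integral_ofReal]
  push_cast
  rfl

theorem s3_eq_integral (r : ℝ) :
    s3 r = 8 / (3 * √π) * ∫ t in (0 : ℝ)..r, t ^ 4 * exp (-t ^ 2) := by
  have hd (t : ℝ) : HasDerivAt (fun t : ℝ => t * ((2 / 3) * t ^ 2 + 1) * exp (-t ^ 2))
      (exp (-t ^ 2) - 4 / 3 * (t ^ 4 * exp (-t ^ 2))) t := by
    have h := ((hasDerivAt_id t).mul ((((hasDerivAt_id t).pow 2).const_mul (2 / 3)).add_const 1)).mul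
      (((hasDerivAt_id t).pow 2).neg).exp
    exact h.congr_deriv (by simp; ring)

  have h := intervalIntegral.integral_eq_sub_of_hasDerivAt (a := 0) (b := r)
    (fun t _ => hd t) (Continuous.intervalIntegrable (by fun_prop) _ _)
  rw [intervalIntegral.integral_sub (Continuous.intervalIntegrable (by fun_prop) _ _)
    (Continuous.intervalIntegrable (by fun_prop) _ _), intervalIntegral.integral_const_mul] at h
  have hπ : √π ≠ 0 := by positivity
  rw [s3, erf]
  field_simp
  linear_combination 6 * h

theorem integral_pow_four_mul_exp_eq (r : ℝ) :
    ∫ t in (0 : ℝ)..r, t ^ 4 * exp (-t ^ 2) =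
      r ^ 5 * ∫ u in (0 : ℝ)..1, u ^ 4 * exp (-(r * u) ^ 2) := by
  have h := intervalIntegral.smul_integral_comp_mul_left (a := 0) (b := 1)
    (fun t : ℝ => t ^ 4 * exp (-t ^ 2)) r
  rw [mul_zero, mul_one] at h
  rw [← h]
  simp only [mul_pow, mul_assoc, intervalIntegral.integral_const_mul, smul_eq_mul]
  ring

/-- `s₃` vanishes to fifth order at `0` through a globally analytic factor:
there is a real-analytic `g : ℝ → ℝ` with `s₃(r) = r⁵ g(r)` for all `r`. -/
theorem s3_factors_analytic :
    ∃ g : ℝ → ℝ, (∀ x : ℝ, AnalyticAt ℝ g x) ∧ ∀ r : ℝ, s3 r = r ^ 5 * g r := by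
  refine ⟨fun r => 8 / (3 * √π) * ∫ u in (0 : ℝ)..1, u ^ 4 * exp (-(r * u) ^ 2),
    fun x => analyticAt_const.mul (analyticAt_integral_pow_four_mul_exp x), fun r => ?_⟩
  rw [s3_eq_integral, integral_pow_four_mul_exp_eq]
  ring
end
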